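/- Let 2 ≤ p < ∞. Then there exist absolute constants c₁ > 0 and c₂ > 0 such that for every N ∈ ℕ and every k ∈ ℕ with 1 < k ≤ N one has (1/4) · min{1, (c₁ · log(1 + N/(k−1))/(k−1))^{1/p}} ≤ d_k(id : ℓ_p^N → ℓ_∞^N) ≤ min{1, (c₂ · log(1 + N/(k−1))/(k−1))^{1/p}}. -/

import Mathlib

open scoped ENNReal

instance : Fact ((1 : ℝ≥0∞) ≤ ∞) := ⟨le_top⟩

/-- The `k`-th Kolmogorov number of a continuous linear operator `T : X → Y`. -/
noncomputable def kolmogorovNumber {X Y : Type*} [NormedAddCommGroup X] [NormedSpace ℂ X]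
    [NormedAddCommGroup Y] [NormedSpace ℂ Y] (T : X →L[ℂ] Y) (k : ℕ) : ℝ :=
  sInf { r | ∃ L : Submodule ℂ Y, Module.rank ℂ L < (k : Cardinal) ∧
    r = ⨆ x : {x : X // ‖x‖ ≤ 1}, ⨅ z : L, ‖T x.1 - (z : Y)‖ }

/-- The identity operator `id : ℓ_{p₁}^N → ℓ_{p₂}^N` on `ℂ^N`. -/
noncomputable def lpId (p₁ p₂ : ℝ≥0∞) [Fact (1 ≤ p₁)] [Fact (1 ≤ p₂)] (N : ℕ) :
    PiLp p₁ (fun _ : Fin N => ℂ) →L[ℂ] PiLp p₂ (fun _ : Fin N => ℂ) :=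
  LinearMap.toContinuousLinearMap
    (((WithLp.linearEquiv p₂ ℂ (Fin N → ℂ)).symm.toLinearMap).comp
      (WithLp.linearEquiv p₁ ℂ (Fin N → ℂ)).toLinearMap)

/-- The sign `±1` encoded by a Boolean. -/
def boolSign (b : Bool) : ℝ := if b then 1 else -1

lemma sum_fin_succ_bool {n : ℕ} (f : (Fin (n + 1) → Bool) → ℝ) :
    ∑ ε, f ε = ∑ ε : Fin n → Bool, (f (Fin.cons true ε) + f (Fin.cons false ε)) := by
  rw [← (Fin.consEquiv fun _ : Fin (n + 1) => Bool).sum_comp f, Fintype.sum_prod_type,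
    Fintype.sum_bool, ← Finset.sum_add_distrib]
  rfl

lemma sum_rademacher_sq {n : ℕ} (z : Fin n → ℝ) :
    ∑ ε : Fin n → Bool, (∑ i, boolSign (ε i) * z i) ^ 2 = 2 ^ n * ∑ i, z i ^ 2 := by
  induction n with
  | zero => simp
  | succ n ih =>
    rw [sum_fin_succ_bool]
    have h : ∀ ε : Fin n → Bool,
        (∑ i, boolSign ((Fin.cons true ε : Fin (n + 1) → Bool) i) * z i) ^ 2
          + (∑ i, boolSign ((Fin.cons false ε : Fin (n + 1) → Bool) i) * z i) ^ 2
        = 2 * z 0 ^ 2 + 2 * (∑ i, boolSign (ε i) * z (Fin.succ i)) ^ 2 := by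
      intro ε
      simp only [Fin.sum_univ_succ, Fin.cons_zero, Fin.cons_succ]
      simp only [boolSign]
      simp only [if_true, Bool.false_eq_true, if_false]
      ring
    simp only [h, Finset.sum_add_distrib, ← Finset.mul_sum, ih fun i => z i.succ]
    simp [Fin.sum_univ_succ, pow_succ]
    ring

lemma sum_rademacher_pow_four_le {n : ℕ} (z : Fin n → ℝ) :
    ∑ ε : Fin n → Bool, (∑ i, boolSign (ε i) * z i) ^ 4 ≤ 3 * 2 ^ n * (∑ i, z i ^ 2) ^ 2 := by
  induction n with
  | zero => simp
  | succ n ih =>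
    rw [sum_fin_succ_bool]
    have h : ∀ ε : Fin n → Bool,
        (∑ i, boolSign ((Fin.cons true ε : Fin (n + 1) → Bool) i) * z i) ^ 4
          + (∑ i, boolSign ((Fin.cons false ε : Fin (n + 1) → Bool) i) * z i) ^ 4
        = 2 * z 0 ^ 4 + 12 * z 0 ^ 2 * (∑ i, boolSign (ε i) * z (Fin.succ i)) ^ 2
          + 2 * (∑ i, boolSign (ε i) * z (Fin.succ i)) ^ 4 := by
      intro ε
      simp only [Fin.sum_univ_succ, Fin.cons_zero, Fin.cons_succ]
      simp only [boolSign]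
      simp only [if_true, Bool.false_eq_true, if_false]
      ring
    have ih' := ih fun i => z i.succ
    simp only [h, Finset.sum_add_distrib, ← Finset.mul_sum, sum_rademacher_sq fun i => z i.succ]
    simp only [Fin.sum_univ_succ, Finset.sum_const, Finset.card_univ, Fintype.card_fun,
      Fintype.card_bool, Fintype.card_fin, nsmul_eq_mul, Nat.cast_pow, Nat.cast_ofNat]
    have h4 : 0 ≤ (2 : ℝ) ^ n * z 0 ^ 4 := by positivity
    rw [pow_succ (2 : ℝ) n]
    nlinarith [ih', h4]

/-- Small-ball estimate for Rademacher sums, in Laplace transform form. -/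
lemma sum_exp_neg_rademacher_sq_le {n : ℕ} (z : Fin n → ℝ) (hz : 0 < ∑ i, z i ^ 2) :
    ∑ ε : Fin n → Bool,
        Real.exp (-((∑ i, boolSign (ε i) * z i) ^ 2 / (3 * ∑ i, z i ^ 2))) ≤ 5 / 6 * 2 ^ n := by
  have hexp : ∀ u : ℝ, 0 ≤ u → Real.exp (-u) ≤ 1 - u + u ^ 2 / 2 := by
    intro u hu
    have h1 : 1 + u + u ^ 2 / 2 ≤ Real.exp u := Real.quadratic_le_exp_of_nonneg hu
    rw [Real.exp_neg, inv_le_comm₀ (Real.exp_pos u) (by nlinarith [sq_nonneg (u - 1)])]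
    refine le_trans ?_ h1
    rw [inv_le_iff_one_le_mul₀ (by nlinarith [sq_nonneg (u - 1)])]
    nlinarith [sq_nonneg (u ^ 2)]
  set S := ∑ i, z i ^ 2 with hS
  calc _ ≤ ∑ ε : Fin n → Bool, (1 - (∑ i, boolSign (ε i) * z i) ^ 2 / (3 * S)
            + ((∑ i, boolSign (ε i) * z i) ^ 2 / (3 * S)) ^ 2 / 2) :=
        Finset.sum_le_sum fun ε _ => hexp _ (by positivity)
    _ = 2 ^ n - (∑ ε : Fin n → Bool, (∑ i, boolSign (ε i) * z i) ^ 2) / (3 * S)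
          + (∑ ε : Fin n → Bool, (∑ i, boolSign (ε i) * z i) ^ 4) / (18 * S ^ 2) := by
        rw [Finset.sum_add_distrib, Finset.sum_sub_distrib, Finset.sum_div, Finset.sum_div]
        congr 1
        · simp
        · refine Finset.sum_congr rfl fun ε _ => ?_
          field_simp
          ring
    _ ≤ 2 ^ n - (2 ^ n * S) / (3 * S) + (3 * 2 ^ n * S ^ 2) / (18 * S ^ 2) := by
        rw [sum_rademacher_sq]
        gcongr
        exact sum_rademacher_pow_four_le z
    _ = 5 / 6 * 2 ^ n := by
        field_simp
        ring

/-- If fewer than exponentially many vectors are given, some sign matrix does not shrink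
any of them much. -/
lemma exists_sign_matrix {σ : Type*} [Fintype σ] {m N : ℕ} (hm : 1 ≤ m) (z : σ → Fin N → ℝ)
    (hcard : (Fintype.card σ : ℝ) ≤ Real.exp (m / 8)) :
    ∃ A : Fin m → Fin N → Bool, ∀ s,
      m / 10 * ∑ i, z s i ^ 2 ≤ ∑ j, (∑ i, boolSign (A j i) * z s i) ^ 2 := by
  by_contra! hbad
  let Q : σ → ℝ := fun s => ∑ i, z s i ^ 2
  let Y : σ → (Fin m → Fin N → Bool) → ℝ := fun s A => ∑ j, (∑ i, boolSign (A j i) * z s i) ^ 2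
  let F : σ → (Fin m → Fin N → Bool) → ℝ := fun s A =>
    if 0 < Q s then Real.exp (m / 30) * Real.exp (-(Y s A / (3 * Q s))) else 0
  have hF0 : ∀ s A, 0 ≤ F s A := by
    intro s A
    simp only [F]
    split_ifs <;> positivity
  have h1 : ∀ A, 1 ≤ ∑ s, F s A := by
    intro A
    obtain ⟨s, hs⟩ := hbad A
    have hY : 0 ≤ Y s A := Finset.sum_nonneg fun _ _ => sq_nonneg _
    have hs' : Y s A < m / 10 * Q s := hs
    have hQ : 0 < Q s := by
      have hmm : (0 : ℝ) < m / 10 := by positivity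
      by_contra h
      nlinarith
    refine le_trans ?_ (Finset.single_le_sum (fun s _ => hF0 s A) (Finset.mem_univ s))
    simp only [F, if_pos hQ]
    rw [← Real.exp_add, Real.one_le_exp_iff, ← sub_eq_add_neg, sub_nonneg, div_le_iff₀ (by positivity)]
    linarith
  have h2 : ∀ s, ∑ A, F s A ≤ (Real.exp (1 / 30) * (5 / 6)) ^ m * (2 ^ N) ^ m := by
    intro s
    simp only [F]
    split_ifs with hQ
    · rw [← Finset.mul_sum]
      have : ∑ A, Real.exp (-(Y s A / (3 * Q s)))
          = (∑ ε : Fin N → Bool,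
              Real.exp (-((∑ i, boolSign (ε i) * z s i) ^ 2 / (3 * ∑ i, z s i ^ 2)))) ^ m := by
        rw [Fintype.sum_pow]
        refine Finset.sum_congr rfl fun A _ => ?_
        rw [← Real.exp_sum, Finset.sum_neg_distrib, ← Finset.sum_div]
      rw [this, mul_pow, mul_assoc, ← mul_pow, ← Real.exp_nat_mul]
      gcongr
      · apply le_of_eq; ring
      · exact sum_exp_neg_rademacher_sq_le _ hQ
    · simp only [Finset.sum_const_zero]
      positivity
  have h3 : ((2 : ℝ) ^ N) ^ m ≤ ∑ A : Fin m → Fin N → Bool, ∑ s, F s A := by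
    calc ((2 : ℝ) ^ N) ^ m = ∑ A : Fin m → Fin N → Bool, (1 : ℝ) := by simp
      _ ≤ _ := Finset.sum_le_sum fun A _ => h1 A
  rw [Finset.sum_comm] at h3
  have h4 : ∑ s, ∑ A, F s A
      ≤ Real.exp (m / 8) * ((Real.exp (1 / 30) * (5 / 6)) ^ m * (2 ^ N) ^ m) := by
    refine (Finset.sum_le_sum fun s _ => h2 s).trans ?_
    rw [Finset.sum_const, nsmul_eq_mul, Finset.card_univ]
    gcongr
  have h5 : Real.exp (1 / 6) < 6 / 5 := by
    have h : Real.exp (1 / 6) ^ 6 < (6 / 5) ^ 6 := by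
      rw [← Real.exp_nat_mul]
      norm_num
      linarith [Real.exp_one_lt_d9]
    exact lt_of_pow_lt_pow_left₀ 6 (by norm_num) h
  have h6 : Real.exp (m / 8) * (Real.exp (1 / 30) * (5 / 6)) ^ m < 1 := by
    have : Real.exp (m / 8) = Real.exp (1 / 8) ^ m := by
      rw [← Real.exp_nat_mul]; ring_nf
    rw [this, ← mul_pow, ← mul_assoc, ← Real.exp_add]
    have h7 : Real.exp (1 / 8 + 1 / 30) ≤ Real.exp (1 / 6) := Real.exp_le_exp.2 (by norm_num)
    exact pow_lt_one₀ (by positivity) (by linarith) (by omega)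
  have h8 : (0 : ℝ) < (2 ^ N) ^ m := by positivity
  nlinarith

/-- Maurey's empirical method. -/
lemma exists_sym_norm_sub_sq_le {H ι : Type*} [NormedAddCommGroup H] [InnerProductSpace ℝ H]
    [Fintype ι] (v : ι → H) (w : ι → ℝ) (hw : ∀ i, 0 ≤ w i) (hw1 : ∑ i, w i = 1) {B : ℝ}
    (hB : ∀ i, ‖v i‖ ^ 2 ≤ B) (n : ℕ) :
    ∃ s : Sym ι n, ‖(n : ℝ) • ∑ i, w i • v i - ((s : Multiset ι).map v).sum‖ ^ 2 ≤ n * B := by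
  induction n with
  | zero => exact ⟨Sym.nil, by simp⟩
  | succ n ih =>
    obtain ⟨s, hs⟩ := ih
    set V := ∑ i, w i • v i with hV
    set S := (n : ℝ) • V - ((s : Multiset ι).map v).sum with hS
    have key : ∑ i, w i * ‖S + (V - v i)‖ ^ 2 ≤ ∑ i, w i * (n * B + B) := by
      have e1 : ∀ i, w i * ‖S + (V - v i)‖ ^ 2
          = w i * ‖S + V‖ ^ 2 - 2 * inner ℝ (S + V) (w i • v i) + w i * ‖v i‖ ^ 2 := by
        intro i
        rw [← add_sub_assoc, norm_sub_sq_real, inner_smul_right]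
        ring
      simp only [e1, Finset.sum_add_distrib, Finset.sum_sub_distrib, ← Finset.mul_sum,
        ← Finset.sum_mul, ← inner_sum, hw1, ← hV]
      have e2 : ∑ i, w i * ‖v i‖ ^ 2 ≤ B := by
        calc _ ≤ ∑ i, w i * B := Finset.sum_le_sum fun i _ => by gcongr; exacts [hw i, hB i]
          _ = B := by rw [← Finset.sum_mul, hw1, one_mul]
      have e3 : ‖S + V‖ ^ 2 - 2 * inner ℝ (S + V) V = ‖S‖ ^ 2 - ‖V‖ ^ 2 := by
        rw [norm_add_sq_real, inner_add_left, real_inner_self_eq_norm_sq]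
        ring
      nlinarith [sq_nonneg ‖V‖]
    obtain ⟨i, hi⟩ : ∃ i, ‖S + (V - v i)‖ ^ 2 ≤ n * B + B := by
      by_contra! hcon
      obtain ⟨i, -, hi⟩ : ∃ i ∈ Finset.univ, 0 < w i :=
        Finset.exists_lt_of_sum_lt (by simp [hw1])
      exact absurd key (not_le.2 (Finset.sum_lt_sum
        (fun j _ => mul_le_mul_of_nonneg_left (hcon j).le (hw j))
        ⟨i, Finset.mem_univ i, mul_lt_mul_of_pos_left (hcon i) hi⟩))
    refine ⟨i ::ₛ s, ?_⟩
    have e : ((n + 1 : ℕ) : ℝ) • V - (((i ::ₛ s : Sym ι (n + 1)) : Multiset ι).map v).sum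
        = S + (V - v i) := by
      simp only [Sym.coe_cons, Multiset.map_cons, Multiset.sum_cons, hS]
      push_cast
      module
    rw [e]
    push_cast
    linarith

lemma choose_mul_pow_le_exp (M n : ℕ) {x : ℝ} (hx : 0 ≤ x) :
    (M.choose n : ℝ) * x ^ n ≤ Real.exp (M * x) := by
  rcases lt_or_ge M n with h | h
  · rw [Nat.choose_eq_zero_of_lt h]
    simp [Real.exp_nonneg]
  · calc (M.choose n : ℝ) * x ^ n ≤ (x + 1) ^ M := by
          rw [add_pow]
          refine le_trans (le_of_eq ?_) (Finset.single_le_sum (fun i _ => by positivity)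
            (Finset.mem_range.2 (Nat.lt_succ_of_le h)))
          simp [mul_comm]
      _ ≤ Real.exp x ^ M := by
          gcongr
          exact Real.add_one_le_exp x
      _ = Real.exp (M * x) := (Real.exp_nat_mul x M).symm

lemma half_le_log_one_add {a : ℝ} (ha : 1 ≤ a) : 1 / 2 ≤ Real.log (1 + a) := by
  have h2 : Real.log 2 ≤ Real.log (1 + a) := Real.log_le_log (by norm_num) (by linarith)
  linarith [Real.log_two_gt_d9]

lemma card_sym_fin_prod_bool_le {m N n : ℕ} (hm : 1 ≤ m) (hmN : m ≤ N)
    (hn : (n : ℝ) * (144 * Real.log (1 + N / m)) ≤ m) :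
    (Fintype.card (Sym (Fin N × Bool) n) : ℝ) ≤ Real.exp (m / 8) := by
  have hm0 : (0 : ℝ) < m := by exact_mod_cast hm
  have hmN' : (m : ℝ) ≤ N := by exact_mod_cast hmN
  have hN0 : (0 : ℝ) < N := hm0.trans_le hmN'
  have ha : 1 ≤ (N : ℝ) / m := (one_le_div hm0).2 hmN'
  have hL := half_le_log_one_add ha
  set L := Real.log (1 + N / m)
  have hn0 : (0 : ℝ) ≤ n := n.cast_nonneg
  have hnm : (n : ℝ) ≤ N := by nlinarith
  rw [Sym.card_sym_eq_choose]
  have hx : (0 : ℝ) < m / (48 * N) := by positivity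
  have h1 := choose_mul_pow_le_exp (Fintype.card (Fin N × Bool) + n - 1) n hx.le
  have hM : ((Fintype.card (Fin N × Bool) + n - 1 : ℕ) : ℝ) ≤ 3 * N := by
    have : Fintype.card (Fin N × Bool) + n - 1 ≤ 3 * N := by
      have : n ≤ N := by exact_mod_cast hnm
      simp
      omega
    exact_mod_cast this
  have h2 : ((Fintype.card (Fin N × Bool) + n - 1 : ℕ) : ℝ) * (m / (48 * N)) ≤ m / 16 := by
    calc _ ≤ (3 * N : ℝ) * (m / (48 * N)) := by gcongr
      _ = m / 16 := by field_simp; norm_num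
  have h3 : Real.exp (-(m / 16)) ≤ (m / (48 * N) : ℝ) ^ n := by
    rw [← Real.exp_log hx, ← Real.exp_nat_mul, Real.exp_le_exp]
    have e : Real.log (m / (48 * N) : ℝ) = -(Real.log 48 + Real.log (N / m)) := by
      rw [← Real.log_mul (by norm_num) (by positivity), ← Real.log_inv]
      congr 1
      field_simp
    have e1 : Real.log 48 ≤ 4 := by
      rw [Real.log_le_iff_le_exp (by norm_num)]
      have : Real.exp 4 = Real.exp 1 ^ 4 := by rw [← Real.exp_nat_mul]; norm_num
      rw [this]
      calc (48 : ℝ) ≤ 2.7 ^ 4 := by norm_num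
        _ ≤ _ := by gcongr; linarith [Real.exp_one_gt_d9]
    have e2 : Real.log (N / m : ℝ) ≤ L := Real.log_le_log (by positivity) (by linarith)
    rw [e]
    have e3 : (n : ℝ) * (Real.log 48 + Real.log (N / m)) ≤ n * (9 * L) := by
      gcongr
      linarith
    linarith
  have h4 := h1.trans (Real.exp_le_exp.2 h2)
  have h5 : Real.exp (m / 8) = Real.exp (m / 16) * Real.exp (m / 16) := by
    rw [← Real.exp_add]; ring_nf
  have h6 : Real.exp (m / 16) * Real.exp (-(m / 16) : ℝ) = 1 := by
    rw [← Real.exp_add]; simp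
  rw [h5]
  refine le_of_mul_le_mul_right ?_ (Real.exp_pos (-(m / 16) : ℝ))
  rw [mul_assoc, h6, mul_one]
  refine le_trans ?_ h4
  gcongr

lemma exists_graph_norm {m N : ℕ} (A : Fin m → Fin N → ℝ) :
    ∃ V : (Fin N → ℝ) →ₗ[ℝ] EuclideanSpace ℝ (Fin N ⊕ Fin m), ∀ x,
      ‖V x‖ ^ 2 = ∑ i, x i ^ 2 + (∑ j, (∑ i, A j i * x i) ^ 2) / m := by
  refine ⟨{ toFun := fun x => WithLp.toLp 2 (Sum.elim x fun j => (∑ i, A j i * x i) / √m)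
            map_add' := ?_
            map_smul' := ?_ }, ?_⟩
  · intro x y
    ext (i | j)
    · simp
    · simp [mul_add, Finset.sum_add_distrib, add_div]
  · intro c x
    ext (i | j)
    · simp
    · simp only [Pi.smul_apply, smul_eq_mul, Sum.elim_inr, RingHom.id_apply, PiLp.smul_apply,
        ← mul_div_assoc, Finset.mul_sum]
      congr 1
      exact Finset.sum_congr rfl fun i _ => by ring
  · intro x
    simp [EuclideanSpace.norm_sq_eq, Finset.sum_div]
    simp only [← Finset.sum_div, div_pow, Real.sq_sqrt m.cast_nonneg]

lemma mul_sum_sq_le_of_ker {m N n : ℕ} (hm : 1 ≤ m) (A : Fin m → Fin N → Bool)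
    (hA : ∀ s : Sym (Fin N × Bool) n, ∀ z : Fin N → ℝ,
      z = ((s : Multiset (Fin N × Bool)).map
        fun p => boolSign p.2 • (Pi.single p.1 1 : Fin N → ℝ)).sum →
      m / 10 * ∑ i, z i ^ 2 ≤ ∑ j, (∑ i, boolSign (A j i) * z i) ^ 2)
    (y : Fin N → ℝ) (hy : ∀ j, ∑ i, boolSign (A j i) * y i = 0) (hy1 : ∑ i, |y i| = 1) :
    n * ∑ i, y i ^ 2 ≤ 44 := by
  have hm0 : (0 : ℝ) < m := by exact_mod_cast hm
  have hsq : ∀ b, boolSign b ^ 2 = 1 := by intro b; cases b <;> simp [boolSign]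
  obtain ⟨V, hV⟩ := exists_graph_norm fun j i => boolSign (A j i)
  let u : Fin N × Bool → Fin N → ℝ := fun p => boolSign p.2 • Pi.single p.1 1
  let w : Fin N × Bool → ℝ := fun p => max (boolSign p.2 * y p.1) 0
  have hw1 : ∑ p, w p = 1 := by
    rw [Fintype.sum_prod_type, ← hy1]
    refine Finset.sum_congr rfl fun i _ => ?_
    simp only [w, Fintype.sum_bool, boolSign]
    rcases le_total 0 (y i) with h | h
    · simp [h, abs_of_nonneg]
    · simp [h, abs_of_nonpos]
  have hwu : ∑ p, w p • V (u p) = V y := by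
    simp only [← map_smul, ← map_sum]
    congr 1
    rw [Fintype.sum_prod_type]
    ext k
    simp only [w, u, Fintype.sum_bool, boolSign, Finset.sum_apply, Pi.add_apply, Pi.smul_apply,
      smul_eq_mul]
    rw [Finset.sum_eq_single k]
    · rcases le_total 0 (y k) with h | h
      · simp [h]
      · simp [h]
    · intro i _ hik
      simp [Pi.single_eq_of_ne hik.symm]
    · simp
  have hB : ∀ p, ‖V (u p)‖ ^ 2 ≤ 2 := by
    intro p
    rw [hV]
    have e1 : ∑ i, u p i ^ 2 = 1 := by
      rw [Finset.sum_eq_single p.1]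
      · simp [u, hsq]
      · intro i _ hi
        simp [u, Pi.single_eq_of_ne hi]
      · simp
    have e2 : ∀ j, (∑ i, boolSign (A j i) * u p i) ^ 2 = 1 := by
      intro j
      rw [Finset.sum_eq_single p.1]
      · simp [u, mul_pow, hsq]
      · intro i _ hi
        simp [u, Pi.single_eq_of_ne hi]
      · simp
    simp only [e1, e2]
    simp
    rw [div_self hm0.ne']
    norm_num
  obtain ⟨s, hs⟩ := exists_sym_norm_sub_sq_le (fun p => V (u p)) w (fun p => le_max_right _ _)
    hw1 hB n
  set z := ((s : Multiset (Fin N × Bool)).map u).sum with hz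
  have hVz : ((s : Multiset (Fin N × Bool)).map fun p => V (u p)).sum = V z := by
    rw [hz, map_multiset_sum, Multiset.map_map]
    rfl
  rw [hwu, hVz, ← map_smul, ← map_sub, hV] at hs
  have e3 : ∀ j, (∑ i, boolSign (A j i) * ((n : ℝ) • y - z) i) ^ 2
      = (∑ i, boolSign (A j i) * z i) ^ 2 := by
    intro j
    have : ∑ i, boolSign (A j i) * ((n : ℝ) • y - z) i
        = n * ∑ i, boolSign (A j i) * y i - ∑ i, boolSign (A j i) * z i := by
      rw [Finset.mul_sum, ← Finset.sum_sub_distrib]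
      exact Finset.sum_congr rfl fun i _ => by simp; ring
    rw [this, hy]
    ring
  simp only [e3] at hs
  have h1 := hA s z rfl
  have h2 : 1 / 10 * ∑ i, z i ^ 2 ≤ (∑ j, (∑ i, boolSign (A j i) * z i) ^ 2) / m := by
    rw [le_div_iff₀ hm0]
    linarith
  have h3 : (n : ℝ) ^ 2 * ∑ i, y i ^ 2
      ≤ 2 * ∑ i, z i ^ 2 + 2 * ∑ i, ((n : ℝ) • y - z) i ^ 2 := by
    rw [Finset.mul_sum, Finset.mul_sum, Finset.mul_sum, ← Finset.sum_add_distrib]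
    refine Finset.sum_le_sum fun i _ => ?_
    simp only [Pi.sub_apply, Pi.smul_apply, smul_eq_mul]
    nlinarith [sq_nonneg (n * y i - 2 * z i)]
  have hd : 0 ≤ ∑ i, ((n : ℝ) • y - z) i ^ 2 := Finset.sum_nonneg fun i _ => sq_nonneg _
  have hz0 : 0 ≤ ∑ i, z i ^ 2 := Finset.sum_nonneg fun i _ => sq_nonneg _
  rcases Nat.eq_zero_or_pos n with rfl | hn
  · simp
  · have hn0 : (0 : ℝ) < n := by exact_mod_cast hn
    refine le_of_mul_le_mul_left ?_ hn0
    nlinarith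

/-- There is a subspace of codimension at most `m` on which the `ℓ₂` norm is much smaller than
the `ℓ₁` norm. -/
lemma exists_matrix_ker_sum_sq_le {m N : ℕ} (hm : 1 ≤ m) (hmN : m ≤ N) :
    ∃ A : Fin m → Fin N → ℝ, ∀ y : Fin N → ℝ, (∀ j, ∑ i, A j i * y i = 0) →
      ∑ i, y i ^ 2 ≤ 12672 * (Real.log (1 + N / m) / m) * (∑ i, |y i|) ^ 2 := by
  have hm0 : (0 : ℝ) < m := by exact_mod_cast hm
  have hL := half_le_log_one_add ((one_le_div hm0).2 (by exact_mod_cast hmN : (m : ℝ) ≤ N))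
  set L := Real.log (1 + N / m)
  set n := ⌊(m : ℝ) / (144 * L)⌋₊ with hn
  have hn1 : (n : ℝ) * (144 * L) ≤ m :=
    (le_div_iff₀ (by positivity)).1 (Nat.floor_le (by positivity))
  obtain ⟨A, hA⟩ := exists_sign_matrix hm
    (fun s : Sym (Fin N × Bool) n => ((s : Multiset (Fin N × Bool)).map
        fun p => boolSign p.2 • (Pi.single p.1 1 : Fin N → ℝ)).sum)
    (card_sym_fin_prod_bool_le hm hmN hn1)
  refine ⟨fun j i => boolSign (A j i), fun y hy => ?_⟩
  have hT0 : 0 ≤ ∑ i, |y i| := Finset.sum_nonneg fun i _ => abs_nonneg _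
  have hn2 : (m : ℝ) < (n + 1) * (144 * L) :=
    (div_lt_iff₀ (by positivity)).1 (Nat.lt_floor_add_one _)
  rcases Nat.eq_zero_or_pos n with h0 | hpos
  · rw [h0] at hn2
    have h1 : ∑ i, y i ^ 2 ≤ (∑ i, |y i|) ^ 2 := by
      simpa only [sq_abs] using
        Finset.sum_sq_le_sq_sum_of_nonneg (s := Finset.univ) (f := fun i => |y i|)
          fun i _ => abs_nonneg _
    have h2 : 1 ≤ 12672 * (L / m) := by
      rw [← mul_div_assoc, one_le_div hm0]
      norm_num at hn2
      linarith
    nlinarith [sq_nonneg (∑ i, |y i|)]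
  · rcases hT0.eq_or_lt with hT | hT
    · have hy0 : ∀ i, y i = 0 := by
        intro i
        have := (Finset.sum_eq_zero_iff_of_nonneg fun i _ => abs_nonneg (y i)).1 hT.symm i
          (Finset.mem_univ i)
        simpa using this
      simp [hy0]
    · set T := ∑ i, |y i| with hTdef
      have key := mul_sum_sq_le_of_ker hm A (fun s z hz => hz ▸ hA s) (fun i => y i / T)
        (fun j => by simp only [← mul_div_assoc, ← Finset.sum_div, hy, zero_div])
        (by simp only [abs_div, abs_of_pos hT, ← Finset.sum_div, ← hTdef, div_self hT.ne'])
      simp only [div_pow, ← Finset.sum_div] at key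
      have hnp : (1 : ℝ) ≤ n := by exact_mod_cast hpos
      rw [← mul_div_assoc, div_le_iff₀ (by positivity)] at key
      have h3 : (m : ℝ) ≤ n * (288 * L) := by nlinarith
      rw [← mul_div_assoc, div_mul_eq_mul_div, le_div_iff₀ hm0]
      have hS : 0 ≤ ∑ i, y i ^ 2 := Finset.sum_nonneg fun i _ => sq_nonneg _
      calc (∑ i, y i ^ 2) * m ≤ (∑ i, y i ^ 2) * (n * (288 * L)) := by gcongr
        _ = (n * ∑ i, y i ^ 2) * (288 * L) := by ring
        _ ≤ 44 * T ^ 2 * (288 * L) := by gcongr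
        _ = 12672 * L * T ^ 2 := by ring

/-- Volumetric packing bound: points of norm at most `5/4` with mutual distances at least `1/2`. -/
lemma card_le_six_pow_of_separated {E : Type*} [NormedAddCommGroup E] [NormedSpace ℝ E]
    [FiniteDimensional ℝ E] (s : Finset E) (hs : ∀ c ∈ s, ‖c‖ ≤ 5 / 4)
    (h : ∀ c ∈ s, ∀ d ∈ s, c ≠ d → 1 / 2 ≤ ‖c - d‖) :
    s.card ≤ 6 ^ Module.finrank ℝ E := by
  borelize E
  let μ : MeasureTheory.Measure E := MeasureTheory.Measure.addHaar
  have hdisj : Set.Pairwise (s : Set E)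
      (Function.onFun Disjoint fun c => Metric.ball (c : E) (1 / 4)) := by
    rintro c hc d hd hcd
    apply Metric.ball_disjoint_ball
    rw [dist_eq_norm]
    linarith [h c hc d hd hcd]
  have hsub : (⋃ c ∈ s, Metric.ball (c : E) (1 / 4)) ⊆ Metric.ball (0 : E) (3 / 2) := by
    refine Set.iUnion₂_subset fun x hx => Metric.ball_subset_ball' ?_
    rw [dist_zero_right]
    linarith [hs x hx]
  have hvol : (s.card : ℝ≥0∞) * ENNReal.ofReal ((1 / 4) ^ Module.finrank ℝ E) * μ (Metric.ball 0 1)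
      ≤ ENNReal.ofReal ((3 / 2) ^ Module.finrank ℝ E) * μ (Metric.ball 0 1) := by
    have h1 := MeasureTheory.measure_mono (μ := μ) hsub
    rw [MeasureTheory.measure_biUnion_finset hdisj fun c _ => measurableSet_ball] at h1
    simpa only [μ.addHaar_ball_of_pos _ (by norm_num : (0 : ℝ) < 1 / 4),
      μ.addHaar_ball_of_pos _ (by norm_num : (0 : ℝ) < 3 / 2), Finset.sum_const, nsmul_eq_mul,
      mul_assoc] using h1
  have hvol' := (ENNReal.mul_le_mul_iff_left (Metric.measure_ball_pos _ _ zero_lt_one).ne'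
    MeasureTheory.measure_ball_lt_top.ne).1 hvol
  have hreal := ENNReal.toReal_le_of_le_ofReal (by positivity) hvol'
  rw [ENNReal.toReal_mul, ENNReal.toReal_ofReal (by positivity), ENNReal.toReal_natCast,
    ← le_div_iff₀ (by positivity), ← div_pow] at hreal
  norm_num at hreal
  exact_mod_cast hreal

lemma div_pow_le_choose {n r : ℕ} (h : r ≤ n) : ((n : ℝ) / r) ^ r ≤ n.choose r := by
  induction r generalizing n with
  | zero => simp
  | succ r ih =>
    obtain ⟨n, rfl⟩ : ∃ n', n = n' + 1 := ⟨n - 1, by omega⟩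
    have hrn : r ≤ n := by omega
    have h1 : ((n + 1).choose (r + 1) : ℝ) = ((n + 1 : ℕ) : ℝ) / (r + 1 : ℕ) * n.choose r := by
      rw [div_mul_eq_mul_div, eq_div_iff (by positivity)]
      exact_mod_cast (Nat.add_one_mul_choose_eq n r).symm
    rw [h1, pow_succ']
    gcongr
    refine le_trans ?_ (ih hrn)
    rcases Nat.eq_zero_or_pos r with rfl | hr
    · simp
    · have hr' : (0 : ℝ) < r := by exact_mod_cast hr
      gcongr ?_ ^ r
      rw [div_le_div_iff₀ (by positivity) hr']
      have : (r : ℝ) ≤ n := by exact_mod_cast hrn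
      push_cast
      linarith

lemma thirty_six_pow_lt_exp {m : ℕ} (hm : 1 ≤ m) : (36 : ℝ) ^ m < Real.exp (4 * m) := by
  have h : (36 : ℝ) < Real.exp 4 := by
    have : Real.exp 4 = Real.exp 1 ^ 4 := by rw [← Real.exp_nat_mul]; norm_num
    rw [this]
    calc (36 : ℝ) < 2.7 ^ 4 := by norm_num
      _ ≤ _ := by gcongr; linarith [Real.exp_one_gt_d9]
  rw [mul_comm, Real.exp_nat_mul]
  exact pow_lt_pow_left₀ h (by norm_num) (by omega)

lemma exists_card_pow_lt_choose {m N : ℕ} (hm : 1 ≤ m) (hN : 300 * m ≤ N) :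
    ∃ s : ℕ, 1 ≤ s ∧ (36 : ℝ) ^ m < N.choose s ∧
      s * min 1 (1 / 90000 * Real.log (1 + N / m) / m) ≤ 1 := by
  have hm0 : (0 : ℝ) < m := by exact_mod_cast hm
  have ha : 300 ≤ (N : ℝ) / m := (le_div_iff₀ hm0).2 (by exact_mod_cast hN)
  have haN : (N : ℝ) / m * m = N := div_mul_cancel₀ _ hm0.ne'
  set a := (N : ℝ) / m with ha_def
  have hL : 1 ≤ Real.log (1 + a) := by
    rw [Real.le_log_iff_exp_le (by linarith)]
    linarith [Real.exp_one_lt_d9]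
  set L := Real.log (1 + a) with hLdef
  rcases le_or_gt (8 * (m : ℝ)) L with h8 | h8
  · refine ⟨1, le_rfl, (thirty_six_pow_lt_exp hm).trans_le ?_, by simp⟩
    have h1 : L ≤ 2 * Real.log a := by
      rw [show 2 * Real.log a = Real.log (a ^ 2) by rw [Real.log_pow]; norm_num]
      exact Real.log_le_log (by linarith) (by nlinarith)
    have h2 : a ≤ N := by
      rw [← haN]
      have : (1 : ℝ) ≤ m := by exact_mod_cast hm
      nlinarith
    rw [Nat.choose_one_right, ← Real.le_log_iff_exp_le (by linarith)]
    have h3 : Real.log a ≤ Real.log N := Real.log_le_log (by linarith) h2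
    linarith
  · have hL0 : 0 < L := by linarith
    have ht : 1 < 8 * m / L := (one_lt_div hL0).2 h8
    set s := ⌈8 * m / L⌉₊ with hs
    have hs1 : 8 * m / L ≤ s := Nat.le_ceil _
    have hs2 : (s : ℝ) < 8 * m / L + 1 := Nat.ceil_lt_add_one (by positivity)
    have hs0 : (0 : ℝ) < s := by linarith
    have hs3 : (s : ℝ) * L ≤ 16 * m := by
      rw [← le_div_iff₀ hL0]
      have : 16 * (m : ℝ) / L = 2 * (8 * m / L) := by ring
      linarith
    have hs4 : 8 * m ≤ s * L := (div_le_iff₀ hL0).1 hs1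
    have hNs : Real.sqrt (1 + a) ≤ N / s := by
      have h1 : Real.sqrt (1 + a) ≤ a / 16 := by
        rw [Real.sqrt_le_left (by linarith)]
        nlinarith
      refine h1.trans ?_
      rw [div_le_div_iff₀ (by norm_num) hs0, ← haN]
      have : (s : ℝ) ≤ 16 * m := by nlinarith
      nlinarith
    have hsN : s ≤ N := by
      have h1 : 1 ≤ Real.sqrt (1 + a) := Real.one_le_sqrt.2 (by linarith)
      exact_mod_cast (one_le_div hs0).1 (h1.trans hNs)
    refine ⟨s, by exact_mod_cast hs0, ?_, ?_⟩
    · refine (thirty_six_pow_lt_exp hm).trans_le (le_trans ?_ (div_pow_le_choose hsN))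
      refine le_trans ?_ (pow_le_pow_left₀ (Real.sqrt_nonneg _) hNs s)
      have h1 : Real.sqrt (1 + a) = Real.exp (L / 2) := by
        rw [← Real.log_sqrt (by linarith), Real.exp_log (Real.sqrt_pos.2 (by linarith))]
      rw [h1, ← Real.exp_nat_mul, Real.exp_le_exp]
      linarith
    · calc s * min 1 (1 / 90000 * L / m) ≤ s * (1 / 90000 * L / m) := by
            gcongr
            exact min_le_right _ _
        _ = (s * L) / (90000 * m) := by ring
        _ ≤ 1 := by
          rw [div_le_one (by positivity)]
          linarith

lemma PiLp.norm_top_le_iff {N : ℕ} (x : PiLp ∞ fun _ : Fin N => ℂ) {r : ℝ} (hr : 0 ≤ r) :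
    ‖x‖ ≤ r ↔ ∀ i, ‖x i‖ ≤ r := by
  rw [PiLp.norm_eq_ciSup]
  exact ⟨fun h i => (le_ciSup (Set.finite_range _).bddAbove i).trans h, fun h => Real.iSup_le h hr⟩

lemma choose_le_pow_of_approx {N s : ℕ} (L : Submodule ℂ (PiLp ∞ fun _ : Fin N => ℂ))
    (h : ∀ S : Finset (Fin N), S.card = s →
      ∃ z ∈ L, ∀ i, ‖(if i ∈ S then (1 : ℂ) else 0) - z i‖ ≤ 1 / 4) :
    N.choose s ≤ 36 ^ Module.finrank ℂ L := by
  choose! z hzL hz using h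
  let f : Finset (Fin N) → L := fun S => if hS : S.card = s then ⟨z S, hzL S hS⟩ else 0
  have hf : ∀ S, S.card = s → ((f S : L) : PiLp ∞ fun _ : Fin N => ℂ) = z S := by
    intro S hS
    simp only [f, dif_pos hS]
  have hsep : ∀ S T : Finset (Fin N), S.card = s → T.card = s → S ≠ T → 1 / 2 ≤ ‖f S - f T‖ := by
    intro S T hS hT hne
    obtain ⟨i, hi⟩ : ∃ i, ¬(i ∈ S ↔ i ∈ T) := by
      by_contra! hcon
      exact hne (Finset.ext hcon)
    rw [Submodule.coe_norm, Submodule.coe_sub, hf S hS, hf T hT]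
    have h1 : ‖z S i - z T i‖ ≤ ‖z S - z T‖ :=
      (PiLp.norm_top_le_iff (z S - z T) (norm_nonneg _)).1 le_rfl i
    have h2 : ‖(if i ∈ S then (1 : ℂ) else 0) - (if i ∈ T then (1 : ℂ) else 0)‖ = 1 := by
      by_cases hiS : i ∈ S <;> by_cases hiT : i ∈ T <;> simp_all
    have h3 : (if i ∈ S then (1 : ℂ) else 0) - (if i ∈ T then (1 : ℂ) else 0)
        = ((if i ∈ S then (1 : ℂ) else 0) - z S i) - ((if i ∈ T then (1 : ℂ) else 0) - z T i)
          + (z S i - z T i) := by ring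
    rw [h3] at h2
    have h4 := norm_add_le (((if i ∈ S then (1 : ℂ) else 0) - z S i)
      - ((if i ∈ T then (1 : ℂ) else 0) - z T i)) (z S i - z T i)
    have h5 := norm_sub_le ((if i ∈ S then (1 : ℂ) else 0) - z S i)
      ((if i ∈ T then (1 : ℂ) else 0) - z T i)
    linarith [hz S hS i, hz T hT i]
  have hinj : Set.InjOn f (Finset.powersetCard s (Finset.univ : Finset (Fin N))) := by
    intro S hS T hT hST
    by_contra hne
    have := hsep S T (Finset.mem_powersetCard.1 hS).2 (Finset.mem_powersetCard.1 hT).2 hne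
    rw [hST, sub_self, norm_zero] at this
    norm_num at this
  classical
  have hcard := card_le_six_pow_of_separated
    ((Finset.powersetCard s (Finset.univ : Finset (Fin N))).image f) ?_ ?_
  · rw [Finset.card_image_of_injOn hinj, Finset.card_powersetCard, Finset.card_univ,
      Fintype.card_fin, finrank_real_of_complex, pow_mul] at hcard
    simpa using hcard
  · intro c hc
    obtain ⟨S, hS, rfl⟩ := Finset.mem_image.1 hc
    have hS' := (Finset.mem_powersetCard.1 hS).2
    rw [Submodule.coe_norm, hf S hS', PiLp.norm_top_le_iff _ (by norm_num)]
    intro i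
    have h1 : z S i = (if i ∈ S then (1 : ℂ) else 0) - ((if i ∈ S then (1 : ℂ) else 0) - z S i) := by
      ring
    have h2 : ‖(if i ∈ S then (1 : ℂ) else 0)‖ ≤ 1 := by split_ifs <;> simp
    rw [h1]
    refine (norm_sub_le _ _).trans ?_
    linarith [hz S hS' i]
  · intro c hc d hd hcd
    obtain ⟨S, hS, rfl⟩ := Finset.mem_image.1 hc
    obtain ⟨T, hT, rfl⟩ := Finset.mem_image.1 hd
    exact hsep S T (Finset.mem_powersetCard.1 hS).2 (Finset.mem_powersetCard.1 hT).2
      fun hST => hcd (hST ▸ rfl)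

lemma norm_sum_mul_le_rpow {N : ℕ} {P ρ : ℝ} (hP : 2 ≤ P) (x y : Fin N → ℂ)
    (hx : ∑ i, ‖x i‖ ^ P ≤ 1) (hy1 : ∑ i, ‖y i‖ ≤ 1) (hy2 : ∑ i, ‖y i‖ ^ 2 ≤ ρ) :
    ‖∑ i, y i * x i‖ ≤ ρ ^ P⁻¹ := by
  have hq : 1 ≤ P / 2 := by linarith
  have hρ : 0 ≤ ρ := (Finset.sum_nonneg fun i _ => sq_nonneg _).trans hy2
  have h0 : 0 ≤ ∑ i, ‖y i‖ * ‖x i‖ ^ (P / 2) := Finset.sum_nonneg fun i _ => by positivity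
  have h1 : ∑ i, ‖y i‖ * ‖x i‖ ^ (P / 2) ≤ ρ ^ (1 / 2 : ℝ) := by
    rw [← Real.sqrt_eq_rpow]
    refine Real.le_sqrt_of_sq_le ((Finset.sum_mul_sq_le_sq_mul_sq _ _ _).trans ?_)
    have : ∑ i, (‖x i‖ ^ (P / 2)) ^ 2 ≤ 1 := by
      refine le_trans (le_of_eq (Finset.sum_congr rfl fun i _ => ?_)) hx
      rw [← Real.rpow_natCast, ← Real.rpow_mul (norm_nonneg _)]
      congr 1
      push_cast
      ring
    calc _ ≤ ρ * 1 := by gcongr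
      _ = ρ := mul_one _
  calc ‖∑ i, y i * x i‖ ≤ ∑ i, ‖y i‖ * ‖x i‖ := by
        refine (norm_sum_le _ _).trans (le_of_eq ?_)
        simp
    _ ≤ (∑ i, ‖y i‖) ^ (1 - (P / 2)⁻¹) * (∑ i, ‖y i‖ * ‖x i‖ ^ (P / 2)) ^ (P / 2)⁻¹ :=
        Real.inner_le_weight_mul_Lp_of_nonneg _ hq _ _ (fun i => norm_nonneg _)
          fun i => norm_nonneg _
    _ ≤ 1 * (ρ ^ (1 / 2 : ℝ)) ^ (P / 2)⁻¹ := by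
        gcongr
        exact Real.rpow_le_one (Finset.sum_nonneg fun i _ => norm_nonneg _) hy1
          (sub_nonneg.2 (inv_le_one_of_one_le₀ hq))
    _ = ρ ^ P⁻¹ := by
        rw [one_mul, ← Real.rpow_mul hρ]
        congr 1
        field_simp

/-- Duality between the distance to a subspace in `ℓ_∞` and the `ℓ₁` norm on its annihilator. -/
lemma exists_annihilator_iInf_le {N : ℕ} (L : Submodule ℂ (PiLp ∞ fun _ : Fin N => ℂ))
    (x : PiLp ∞ fun _ : Fin N => ℂ) :
    ∃ y : Fin N → ℂ, (∀ z ∈ L, ∑ i, y i * z i = 0) ∧ ∑ i, ‖y i‖ ≤ 1 ∧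
      ⨅ z : L, ‖x - (z : PiLp ∞ fun _ : Fin N => ℂ)‖ ≤ ‖∑ i, y i * x i‖ := by
  obtain ⟨g, hg, hgx⟩ := exists_dual_vector'' ℂ (L.mkQ x)
  let e : Fin N → PiLp ∞ fun _ : Fin N => ℂ := fun i => WithLp.toLp ∞ (Pi.single i 1)
  have hdec : ∀ z : PiLp ∞ fun _ : Fin N => ℂ, g (L.mkQ z) = ∑ i, g (L.mkQ (e i)) * z i := by
    intro z
    have : z = ∑ i, z i • e i := by
      ext j
      simp [e, Pi.single_apply]
    conv_lhs => rw [this]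
    simp [mul_comm]
  refine ⟨fun i => g (L.mkQ (e i)), fun z hz => ?_, ?_, ?_⟩
  · rw [← hdec, (Submodule.Quotient.mk_eq_zero L).2 hz |> (L.mkQ_apply z).trans, map_zero]
  · let u : PiLp ∞ fun _ : Fin N => ℂ := WithLp.toLp ∞ fun i =>
      (starRingEnd ℂ) (g (L.mkQ (e i))) / (‖g (L.mkQ (e i))‖ : ℂ)
    have hu : ‖u‖ ≤ 1 := by
      rw [PiLp.norm_top_le_iff _ zero_le_one]
      intro i
      simp only [u, norm_div, RCLike.norm_conj, Complex.norm_real, norm_norm]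
      exact div_self_le_one _
    have h1 : g (L.mkQ u) = ((∑ i, ‖g (L.mkQ (e i))‖ : ℝ) : ℂ) := by
      rw [hdec, Complex.ofReal_sum]
      refine Finset.sum_congr rfl fun i _ => ?_
      simp only [u]
      rw [← mul_div_assoc, Complex.mul_conj']
      rcases eq_or_ne (‖g (L.mkQ (e i))‖ : ℂ) 0 with h | h
      · rw [h]; simp
      · field_simp
    have h2 : ‖g (L.mkQ u)‖ ≤ 1 := by
      refine (g.le_of_opNorm_le hg _).trans ?_
      rw [one_mul]
      exact (Submodule.Quotient.norm_mk_le L u).trans hu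
    rw [h1, Complex.norm_real] at h2
    exact (le_abs_self _).trans h2
  · rw [← hdec, hgx]
    have : ‖L.mkQ x‖ = Metric.infDist x L := QuotientAddGroup.norm_mk (S := L.toAddSubgroup) x
    rw [RCLike.norm_ofReal, abs_norm, this, Metric.infDist_eq_iInf]
    simp only [dist_eq_norm]
    exact le_rfl

lemma kolmogorovNumber_le {X Y : Type*} [NormedAddCommGroup X] [NormedSpace ℂ X]
    [NormedAddCommGroup Y] [NormedSpace ℂ Y] (T : X →L[ℂ] Y) {k : ℕ} {r : ℝ}
    (L : Submodule ℂ Y) (hL : Module.rank ℂ L < (k : Cardinal))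
    (h : ∀ x, ‖x‖ ≤ 1 → ⨅ z : L, ‖T x - (z : Y)‖ ≤ r) : kolmogorovNumber T k ≤ r := by
  have : Nonempty {x : X // ‖x‖ ≤ 1} := ⟨⟨0, by simp⟩⟩
  refine le_trans ?_ (ciSup_le fun x : {x : X // ‖x‖ ≤ 1} => h x.1 x.2)
  refine csInf_le ⟨0, ?_⟩ ⟨L, hL, rfl⟩
  rintro _ ⟨L', -, rfl⟩
  exact Real.iSup_nonneg fun x => Real.iInf_nonneg fun z => norm_nonneg _

lemma le_kolmogorovNumber {X Y : Type*} [NormedAddCommGroup X] [NormedSpace ℂ X]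
    [NormedAddCommGroup Y] [NormedSpace ℂ Y] (T : X →L[ℂ] Y) {k : ℕ} (hk : 0 < k) {r : ℝ}
    (h : ∀ L : Submodule ℂ Y, Module.rank ℂ L < (k : Cardinal) →
      ∃ x, ‖x‖ ≤ 1 ∧ ∀ z ∈ L, r ≤ ‖T x - z‖) : r ≤ kolmogorovNumber T k := by
  refine le_csInf ⟨_, ⊥, by simpa using hk, rfl⟩ ?_
  rintro _ ⟨L, hL, rfl⟩
  obtain ⟨x, hx, hxz⟩ := h L hL
  refine le_ciSup_of_le ⟨‖T‖, ?_⟩ (⟨x, hx⟩ : {x : X // ‖x‖ ≤ 1}) (le_ciInf fun z => hxz z z.2)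
  rintro _ ⟨x, rfl⟩
  refine (ciInf_le ⟨0, ?_⟩ (0 : L)).trans ?_
  · rintro _ ⟨z, rfl⟩
    exact norm_nonneg _
  · simpa using T.le_of_opNorm_le_of_le le_rfl x.2

lemma PiLp.norm_le_one_iff_sum_rpow {N : ℕ} {p : ℝ≥0∞} (hp : 0 < p.toReal)
    (x : PiLp p fun _ : Fin N => ℂ) : ‖x‖ ≤ 1 ↔ ∑ i, ‖x i‖ ^ p.toReal ≤ 1 := by
  have h0 : 0 ≤ ∑ i, ‖x i‖ ^ p.toReal := Finset.sum_nonneg fun i _ => by positivity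
  rw [PiLp.norm_eq_sum hp, one_div, Real.rpow_inv_le_iff_of_pos h0 zero_le_one hp, Real.one_rpow]

lemma kolmogorovNumber_lpId_le_one {p : ℝ≥0∞} [Fact (1 ≤ p)] (hp : 0 < p.toReal) {N k : ℕ}
    (hk : 0 < k) : kolmogorovNumber (lpId p ∞ N) k ≤ 1 := by
  refine kolmogorovNumber_le _ ⊥ (by simpa using hk) fun x hx => ?_
  refine (ciInf_le ⟨0, ?_⟩ 0).trans ?_
  · rintro _ ⟨z, rfl⟩
    exact norm_nonneg _
  · rw [ZeroMemClass.coe_zero, sub_zero, PiLp.norm_top_le_iff _ zero_le_one]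
    intro i
    have h1 : ‖x i‖ ^ p.toReal ≤ 1 :=
      (Finset.single_le_sum (f := fun i => ‖x i‖ ^ p.toReal) (fun i _ => by positivity)
        (Finset.mem_univ i)).trans ((PiLp.norm_le_one_iff_sum_rpow hp x).1 hx)
    by_contra! hcon
    exact absurd h1 (not_le.2 (Real.one_lt_rpow hcon hp))

lemma kolmogorovNumber_lpId_le {p : ℝ≥0∞} [Fact (1 ≤ p)] (hp : 2 ≤ p.toReal) {N m : ℕ}
    (hm : 1 ≤ m) (hmN : m ≤ N) :
    kolmogorovNumber (lpId p ∞ N) (m + 1)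
      ≤ (25344 * Real.log (1 + N / m) / m) ^ p.toReal⁻¹ := by
  obtain ⟨A, hA⟩ := exists_matrix_ker_sum_sq_le hm hmN
  have hρ : 0 ≤ Real.log (1 + N / m) / m :=
    div_nonneg (Real.log_nonneg (by linarith [show (0 : ℝ) ≤ N / m by positivity])) m.cast_nonneg
  let row : Fin m → PiLp ∞ fun _ : Fin N => ℂ := fun j => WithLp.toLp ∞ fun i => (A j i : ℂ)
  have hrank : Module.rank ℂ (Submodule.span ℂ (Set.range row)) < ((m + 1 : ℕ) : Cardinal) := by
    refine (rank_span_le _).trans_lt (Cardinal.mk_range_le.trans_lt ?_)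
    simp only [Cardinal.mk_fin]
    exact_mod_cast m.lt_succ_self
  refine kolmogorovNumber_le _ _ hrank fun x hx => ?_
  obtain ⟨y, hyL, hy1, hyx⟩ := exists_annihilator_iInf_le (Submodule.span ℂ (Set.range row))
    (lpId p ∞ N x)
  refine hyx.trans (norm_sum_mul_le_rpow hp _ y
    ((PiLp.norm_le_one_iff_sum_rpow (by linarith) x).1 hx) hy1 ?_)
  have hrow : ∀ j, ∑ i, y i * (A j i : ℂ) = 0 := fun j =>
    hyL (row j) (Submodule.subset_span ⟨j, rfl⟩)
  have hre := hA (fun i => (y i).re) fun j => by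
    simpa [mul_comm] using congrArg Complex.re (hrow j)
  have him := hA (fun i => (y i).im) fun j => by
    simpa [mul_comm] using congrArg Complex.im (hrow j)
  have hle : ∀ f : Fin N → ℝ, (∀ i, |f i| ≤ ‖y i‖) → (∑ i, |f i|) ^ 2 ≤ 1 := fun f hf =>
    pow_le_one₀ (Finset.sum_nonneg fun i _ => abs_nonneg _)
      ((Finset.sum_le_sum fun i _ => hf i).trans hy1)
  have hre1 := hle _ fun i => Complex.abs_re_le_norm (y i)
  have him1 := hle _ fun i => Complex.abs_im_le_norm (y i)
  have hsplit : ∑ i, ‖y i‖ ^ 2 = ∑ i, (y i).re ^ 2 + ∑ i, (y i).im ^ 2 := by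
    rw [← Finset.sum_add_distrib]
    refine Finset.sum_congr rfl fun i _ => ?_
    rw [Complex.sq_norm, Complex.normSq_apply]
    ring
  rw [hsplit, mul_div_assoc]
  nlinarith

lemma le_kolmogorovNumber_lpId_of_le {p : ℝ≥0∞} [Fact (1 ≤ p)] (hp : 0 < p.toReal) {N k : ℕ}
    (hk : 0 < k) (hkN : k ≤ N) :
    1 / 2 * (1 / N : ℝ) ^ p.toReal⁻¹ ≤ kolmogorovNumber (lpId p ∞ N) k := by
  have hN0 : (0 : ℝ) < N := by exact_mod_cast hk.trans_le hkN
  refine le_kolmogorovNumber _ hk fun L hL => ?_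
  have hLtop : ∃ x, x ∉ L := by
    by_contra! hcon
    have : L = ⊤ := eq_top_iff.2 fun x _ => hcon x
    rw [this, rank_top, ← Module.finrank_eq_rank, (WithLp.linearEquiv ∞ ℂ (Fin N → ℂ)).finrank_eq,
      Module.finrank_fin_fun] at hL
    exact absurd hkN (not_le.2 (by exact_mod_cast hL))
  obtain ⟨x₀, hx₀, hdist⟩ := riesz_lemma L.closed_of_finiteDimensional hLtop
    (by norm_num : (1 / 2 : ℝ) < 1)
  have hx₀0 : 0 < ‖x₀‖ := norm_pos_iff.2 fun h => hx₀ (h ▸ L.zero_mem)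
  set t : ℝ := (1 / N : ℝ) ^ p.toReal⁻¹ / ‖x₀‖ with ht
  have ht0 : 0 < t := by positivity
  have htx : t * ‖x₀‖ = (1 / N : ℝ) ^ p.toReal⁻¹ := div_mul_cancel₀ _ hx₀0.ne'
  refine ⟨WithLp.toLp p ((t : ℂ) • x₀).ofLp, ?_, fun z hz => ?_⟩
  · rw [PiLp.norm_le_one_iff_sum_rpow hp]
    have : ∀ i, ‖((t : ℂ) • x₀) i‖ ^ p.toReal ≤ 1 / N := by
      intro i
      have h1 : ‖((t : ℂ) • x₀) i‖ ≤ (1 / N : ℝ) ^ p.toReal⁻¹ := by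
        rw [← htx, PiLp.smul_apply, norm_smul, Complex.norm_real, Real.norm_of_nonneg ht0.le]
        gcongr
        exact (PiLp.norm_top_le_iff x₀ (norm_nonneg _)).1 le_rfl i
      calc _ ≤ ((1 / N : ℝ) ^ p.toReal⁻¹) ^ p.toReal := by gcongr
        _ = 1 / N := Real.rpow_inv_rpow (by positivity) hp.ne'
    calc _ ≤ ∑ i : Fin N, (1 / N : ℝ) := Finset.sum_le_sum fun i _ => this i
      _ = 1 := by simp [hN0.ne']
  · have h1 : lpId p ∞ N (WithLp.toLp p ((t : ℂ) • x₀).ofLp) - z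
        = (t : ℂ) • (x₀ - (t : ℂ)⁻¹ • z) := by
      rw [smul_sub, smul_inv_smul₀ (by exact_mod_cast ht0.ne')]
      rfl
    rw [h1, norm_smul, Complex.norm_real, Real.norm_of_nonneg ht0.le, ← htx]
    nlinarith [hdist _ (L.smul_mem (t : ℂ)⁻¹ hz)]

lemma le_kolmogorovNumber_lpId_of_pow_lt_choose {p : ℝ≥0∞} [Fact (1 ≤ p)] (hp : 0 < p.toReal)
    {N m s : ℕ} (hs : 1 ≤ s) (hchoose : (36 : ℝ) ^ m < N.choose s) :
    1 / 4 * (1 / s : ℝ) ^ p.toReal⁻¹ ≤ kolmogorovNumber (lpId p ∞ N) (m + 1) := by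
  have hs0 : (0 : ℝ) < s := by exact_mod_cast hs
  refine le_kolmogorovNumber _ m.succ_pos fun L hL => ?_
  by_contra! hcon
  set t : ℝ := (1 / s : ℝ) ^ p.toReal⁻¹ with ht
  have ht0 : 0 < t := by positivity
  have htp : t ^ p.toReal = 1 / s := Real.rpow_inv_rpow (by positivity) hp.ne'
  have hfin : Module.finrank ℂ L ≤ m := by
    rw [← Module.finrank_eq_rank] at hL
    exact Nat.lt_succ_iff.1 (by exact_mod_cast hL)
  have hle := choose_le_pow_of_approx (s := s) L fun S hS => by
    obtain ⟨z, hzL, hz⟩ := hcon (WithLp.toLp p fun i => if i ∈ S then (t : ℂ) else 0) (by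
      rw [PiLp.norm_le_one_iff_sum_rpow hp]
      have h1 : ∀ i, ‖if i ∈ S then (t : ℂ) else 0‖ ^ p.toReal = if i ∈ S then (1 / s : ℝ) else 0 := by
        intro i
        split_ifs
        · rw [Complex.norm_real, Real.norm_of_nonneg ht0.le, htp]
        · rw [norm_zero, Real.zero_rpow hp.ne']
      simp only [h1]
      simp [hS, hs0.ne'])
    refine ⟨(t : ℂ)⁻¹ • z, L.smul_mem _ hzL, fun i => ?_⟩
    have h2 := (PiLp.norm_top_le_iff _ (by positivity)).1 hz.le i
    have h3 : (if i ∈ S then (1 : ℂ) else 0) - ((t : ℂ)⁻¹ • z) i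
        = (t : ℂ)⁻¹ * ((if i ∈ S then (t : ℂ) else 0) - z i) := by
      have htc : (t : ℂ) ≠ 0 := by exact_mod_cast ht0.ne'
      rw [PiLp.smul_apply, smul_eq_mul, mul_sub]
      split_ifs <;> simp [htc]
    rw [h3, norm_mul, norm_inv, Complex.norm_real, Real.norm_of_nonneg ht0.le,
      inv_mul_le_iff₀ ht0, mul_comm]
    exact h2
  have hle' : (N.choose s : ℝ) ≤ 36 ^ m := by
    exact_mod_cast hle.trans (Nat.pow_le_pow_right (by norm_num) hfin)
  linarith

lemma le_kolmogorovNumber_lpId {p : ℝ≥0∞} [Fact (1 ≤ p)] (hp : 0 < p.toReal) {N m : ℕ}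
    (hm : 1 ≤ m) (hmN : m + 1 ≤ N) :
    1 / 4 * min 1 ((1 / 90000 * Real.log (1 + N / m) / m) ^ p.toReal⁻¹)
      ≤ kolmogorovNumber (lpId p ∞ N) (m + 1) := by
  have hm0 : (0 : ℝ) < m := by exact_mod_cast hm
  have hN0 : (0 : ℝ) < N := by exact_mod_cast (Nat.succ_pos m).trans_le hmN
  have ha : 0 < (N : ℝ) / m := by positivity
  have hL0 : 0 ≤ Real.log (1 + N / m) := Real.log_nonneg (by linarith)
  set X := 1 / 90000 * Real.log (1 + N / m) / m with hX
  have hX0 : 0 ≤ X := by positivity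
  rcases le_or_gt (300 * m) N with h | h
  · obtain ⟨s, hs, hchoose, hsX⟩ := exists_card_pow_lt_choose hm h
    have hs0 : (0 : ℝ) < s := by exact_mod_cast hs
    refine le_trans ?_ (le_kolmogorovNumber_lpId_of_pow_lt_choose hp hs hchoose)
    gcongr
    have h1 : min 1 X ≤ 1 / s := by
      rw [le_div_iff₀ hs0, mul_comm]
      exact hsX
    refine le_trans ?_ (Real.rpow_le_rpow (by positivity) h1 (by positivity))
    rcases le_total 1 X with h2 | h2
    · rw [min_eq_left h2, Real.one_rpow]
      exact min_le_left _ _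
    · rw [min_eq_right h2]
      exact min_le_right _ _
  · refine le_trans ?_ (le_kolmogorovNumber_lpId_of_le hp m.succ_pos hmN)
    have h300 : (N : ℝ) / m ≤ 300 := (div_le_iff₀ hm0).2 (by exact_mod_cast h.le)
    have h1 : X ≤ 1 / N := by
      have h2 : Real.log (1 + N / m) ≤ 300 := by
        linarith [Real.log_le_sub_one_of_pos (show 0 < 1 + (N : ℝ) / m by linarith)]
      rw [hX, div_le_div_iff₀ hm0 hN0]
      have h3 : (N : ℝ) ≤ 300 * m := (div_le_iff₀ hm0).1 h300
      nlinarith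
    gcongr
    · norm_num
    · exact (min_le_right _ _).trans (Real.rpow_le_rpow hX0 h1 (by positivity))

/-- For `2 ≤ p < ∞` and `1 < k ≤ N`:
`(1/4) min{1, (c₁ log(1 + N/(k-1))/(k-1))^{1/p}} ≤ d_k(id : ℓ_p^N → ℓ_∞^N)
  ≤ min{1, (c₂ log(1 + N/(k-1))/(k-1))^{1/p}}` for absolute constants `c₁, c₂ > 0`. -/
theorem stmt9 :
    ∃ c₁ c₂ : ℝ, 0 < c₁ ∧ 0 < c₂ ∧
      ∀ (p : ℝ≥0∞) [Fact (1 ≤ p)], 2 ≤ p → p < ∞ →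
        ∀ N k : ℕ, 1 < k → k ≤ N →
          (1/4 : ℝ) * min 1 ((c₁ * Real.log (1 + (N : ℝ) / ((k : ℝ) - 1)) / ((k : ℝ) - 1))
                ^ ((p⁻¹).toReal))
              ≤ kolmogorovNumber (lpId p ∞ N) k ∧
          kolmogorovNumber (lpId p ∞ N) k
              ≤ min 1 ((c₂ * Real.log (1 + (N : ℝ) / ((k : ℝ) - 1)) / ((k : ℝ) - 1))
                ^ ((p⁻¹).toReal)) := by
  refine ⟨1 / 90000, 25344, by norm_num, by norm_num, fun p _ hp2 hp N k hk hkN => ?_⟩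
  obtain ⟨m, rfl⟩ : ∃ m, k = m + 1 := ⟨k - 1, by omega⟩
  have hp' : 2 ≤ p.toReal := by simpa using ENNReal.toReal_mono hp.ne hp2
  have hp0 : 0 < p.toReal := by linarith
  rw [ENNReal.toReal_inv, Nat.cast_add, Nat.cast_one, add_sub_cancel_right]
  exact ⟨le_kolmogorovNumber_lpId hp0 (by omega) hkN,
    le_min (kolmogorovNumber_lpId_le_one hp0 m.succ_pos)
      (kolmogorovNumber_lpId_le hp' (by omega) (by omega))⟩
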